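/- Let E be a normed space and 1 ≤ p ≤ q < ∞. Suppose f : E → E is such that f ∘ x ∈ BV_q([a,b],E) for every x ∈ BV_p([a,b],E). Then f is Hölder continuous with exponent p/q on every precompact subset of E. -/

import Mathlib

open scoped ENNReal NNReal

/-- The Wiener `p`-variation of `x : ℝ → E` over `[a,b]`: the supremum over all
finite partitions `a = t₀ < … < tₙ = b` of `∑ᵢ ‖x(tᵢ) - x(tᵢ₋₁)‖ ^ p`. -/
noncomputable def pVar {E : Type*} [NormedAddCommGroup E] (p a b : ℝ) (x : ℝ → E) : ℝ≥0∞ :=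
  ⨆ (n : ℕ) (t : Fin (n + 1) → ℝ) (_ : StrictMono t) (_ : t 0 = a)
    (_ : t (Fin.last n) = b),
    ∑ i : Fin n, (‖x (t i.succ) - x (t i.castSucc)‖₊ : ℝ≥0∞) ^ p

open Filter

/-- Every sequence in a totally bounded set has a Cauchy subsequence. -/
theorem TotallyBounded.exists_cauchySeq_subseq {E : Type*} [PseudoMetricSpace E] {K : Set E}
    (hK : TotallyBounded K) {u : ℕ → E} (hu : ∀ n, u n ∈ K) :
    ∃ φ : ℕ → ℕ, StrictMono φ ∧ CauchySeq (u ∘ φ) := by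
  have hc : IsCompact (_root_.closure ((fun z : E => (z : UniformSpace.Completion E)) '' K)) :=
    (hK.image (UniformSpace.Completion.uniformContinuous_coe E)).closure.isCompact_of_isClosed
      isClosed_closure
  obtain ⟨l, -, φ, hφ, hl⟩ := hc.tendsto_subseq
    (x := fun n => (u n : UniformSpace.Completion E))
    fun n => subset_closure ⟨u n, hu n, rfl⟩
  refine ⟨φ, hφ, ((UniformSpace.Completion.isUniformInducing_coe E).cauchy_map_iff).1 ?_⟩
  rw [map_map]
  exact hl.cauchySeq

section pVar

variable {E : Type*} [NormedAddCommGroup E]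

theorem coe_nnnorm_rpow_eq_ofReal {p : ℝ} (hp : 0 ≤ p) (z : E) :
    (‖z‖₊ : ℝ≥0∞) ^ p = ENNReal.ofReal (‖z‖ ^ p) := by
  rw [← ENNReal.ofReal_rpow_of_nonneg (norm_nonneg _) hp, ofReal_norm]
  rfl

/-- A function whose increments are controlled by those of a real function has finite
`p`-variation. -/
theorem pVar_ne_top_of_control {p a b : ℝ} (hp : 0 ≤ p) {x : ℝ → E} (G : ℝ → ℝ)
    (hG : ∀ s t, a ≤ s → s < t → t ≤ b → ‖x t - x s‖ ^ p ≤ G t - G s) :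
    pVar p a b x ≠ ⊤ := by
  refine ne_top_of_le_ne_top (ENNReal.ofReal_ne_top (r := G b - G a)) ?_
  refine iSup_le fun n => iSup_le fun t => iSup_le fun ht => iSup_le fun h0 => iSup_le fun h1 => ?_
  have hstep : ∀ i : Fin n, ‖x (t i.succ) - x (t i.castSucc)‖ ^ p ≤
      G (t i.succ) - G (t i.castSucc) := fun i =>
    hG _ _ (h0 ▸ ht.monotone (Fin.zero_le _)) (ht i.castSucc_lt_succ)
      (h1 ▸ ht.monotone (Fin.le_last _))
  have htel : ∑ i : Fin n, (G (t i.succ) - G (t i.castSucc)) = G b - G a := by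
    rw [Finset.sum_sub_distrib, ← h0, ← h1]
    linarith [Fin.sum_univ_succ fun i => G (t i), Fin.sum_univ_castSucc fun i => G (t i)]
  simp_rw [coe_nnnorm_rpow_eq_ofReal hp]
  rw [← ENNReal.ofReal_sum_of_nonneg fun i _ => by positivity, ← htel]
  exact ENNReal.ofReal_le_ofReal (Finset.sum_le_sum fun i _ => hstep i)

/-- Finite sums over interior points are bounded by the `p`-variation. -/
theorem sum_le_pVar {p a b : ℝ} (hp : 0 ≤ p) {x : ℝ → E} (hx : pVar p a b x ≠ ⊤) {n : ℕ}
    (s : Fin (n + 1) → ℝ) (hs : StrictMono s) (ha : ∀ i, a < s i) (hb : ∀ i, s i < b) :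
    ∑ i : Fin n, ‖x (s i.succ) - x (s i.castSucc)‖ ^ p ≤ (pVar p a b x).toReal := by
  rw [← ENNReal.ofReal_le_iff_le_toReal hx, ENNReal.ofReal_sum_of_nonneg
    fun i _ => by positivity]
  simp_rw [← coe_nnnorm_rpow_eq_ofReal hp]
  let t : Fin (n + 2 + 1) → ℝ := Fin.cons a (Fin.snoc s b)
  have hsnoc : StrictMono (Fin.snoc s b : Fin (n + 2) → ℝ) := by
    refine Fin.strictMono_iff_lt_succ.2 fun i => ?_
    induction i using Fin.lastCases with
    | last => simpa using hb _
    | cast i =>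
      rw [Fin.succ_castSucc, Fin.snoc_castSucc (α := fun _ => ℝ),
        Fin.snoc_castSucc (α := fun _ => ℝ)]
      exact hs i.castSucc_lt_succ
  have ht : StrictMono t := by
    refine Fin.strictMono_iff_lt_succ.2 fun i => ?_
    induction i using Fin.cases with
    | zero =>
      have := ha 0
      rw [← Fin.snoc_castSucc (α := fun _ => ℝ) b s 0] at this
      simpa [t] using this
    | succ i =>
      rw [← Fin.succ_castSucc]
      simp only [t, Fin.cons_succ]
      exact hsnoc i.castSucc_lt_succ
  have h0 : t 0 = a := rfl
  have h1 : t (Fin.last _) = b := by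
    rw [← Fin.succ_last]
    simp [t]
  calc ∑ i : Fin n, (‖x (s i.succ) - x (s i.castSucc)‖₊ : ℝ≥0∞) ^ p
      ≤ ∑ i : Fin (n + 2), (‖x (t i.succ) - x (t i.castSucc)‖₊ : ℝ≥0∞) ^ p := by
        rw [Fin.sum_univ_succ, Fin.sum_univ_castSucc]
        refine le_trans (le_of_eq ?_) (le_add_left (le_add_right le_rfl))
        refine Finset.sum_congr rfl fun i _ => ?_
        have e1 : t i.castSucc.succ.succ = s i.succ := by
          simp only [t, Fin.cons_succ]
          rw [Fin.succ_castSucc, Fin.snoc_castSucc (α := fun _ => ℝ)]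
        have e2 : t i.castSucc.succ.castSucc = s i.castSucc := by
          simp only [t]
          rw [← Fin.succ_castSucc, Fin.cons_succ, Fin.snoc_castSucc (α := fun _ => ℝ)]
        rw [e1, e2]
    _ ≤ pVar p a b x :=
        le_iSup_of_le (n + 2) <| le_iSup_of_le t <| le_iSup_of_le ht <| le_iSup_of_le h0 <|
          le_iSup_of_le h1 le_rfl

end pVar

section BlockStep

/-- The index of the subinterval containing `r` when `[n, n + 1)` is divided into `m n + 1`
equal parts, where `n = ⌊r⌋₊`. -/
noncomputable def subIndex (m : ℕ → ℕ) (r : ℝ) : ℕ :=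
  ⌊((m ⌊r⌋₊ : ℝ) + 1) * (r - ⌊r⌋₊)⌋₊

theorem subIndex_le (m : ℕ → ℕ) (r : ℝ) : subIndex m r ≤ m ⌊r⌋₊ := by
  have h : r < ⌊r⌋₊ + 1 := Nat.lt_floor_add_one r
  refine Nat.lt_succ_iff.1 ((Nat.floor_lt' (Nat.succ_ne_zero _)).2 ?_)
  push_cast
  nlinarith [(Nat.cast_nonneg (m ⌊r⌋₊) : (0 : ℝ) ≤ m ⌊r⌋₊)]

theorem subIndex_mono {m : ℕ → ℕ} {r s : ℝ} (h : r ≤ s) (hf : ⌊r⌋₊ = ⌊s⌋₊) :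
    subIndex m r ≤ subIndex m s := by
  unfold subIndex
  rw [hf]
  gcongr

/-- The midpoint of the `j`-th of the `m n + 1` subintervals of `[n, n + 1)`. -/
noncomputable def subMidpoint (m : ℕ → ℕ) (n j : ℕ) : ℝ :=
  n + (j + 1 / 2) / ((m n : ℝ) + 1)

theorem subMidpoint_strictMono (m : ℕ → ℕ) (n : ℕ) : StrictMono (subMidpoint m n) := by
  intro i j hij
  unfold subMidpoint
  gcongr

theorem cast_lt_subMidpoint (m : ℕ → ℕ) (n j : ℕ) : (n : ℝ) < subMidpoint m n j := by
  have : (0 : ℝ) < (j + 1 / 2) / ((m n : ℝ) + 1) := by positivity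
  unfold subMidpoint
  linarith

theorem floor_subMidpoint {m : ℕ → ℕ} {n j : ℕ} (hj : j ≤ m n) : ⌊subMidpoint m n j⌋₊ = n := by
  have hj' : (j : ℝ) ≤ m n := by exact_mod_cast hj
  refine (Nat.floor_eq_iff ((Nat.cast_nonneg n).trans (cast_lt_subMidpoint m n j).le)).2
    ⟨(cast_lt_subMidpoint m n j).le, ?_⟩
  unfold subMidpoint
  have : ((j : ℝ) + 1 / 2) / ((m n : ℝ) + 1) < 1 := by
    rw [div_lt_one (by positivity)]
    linarith
  linarith

theorem subIndex_subMidpoint {m : ℕ → ℕ} {n j : ℕ} (hj : j ≤ m n) :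
    subIndex m (subMidpoint m n j) = j := by
  unfold subIndex
  rw [floor_subMidpoint hj]
  unfold subMidpoint
  rw [add_sub_cancel_left, mul_div_cancel₀ _ (by positivity),
    Nat.floor_eq_iff (by positivity)]
  constructor <;> linarith

/-- A control function for the step function taking the value `y n j` on the `j`-th of the
`m n + 1` subintervals of `[n, n + 1)`. -/
noncomputable def blockControl (m : ℕ → ℕ) (c e : ℕ → ℝ) (r : ℝ) : ℝ :=
  ∑ k ∈ Finset.range ⌊r⌋₊, (((m k : ℝ) + 1) * c k + e k) + c ⌊r⌋₊ * subIndex m r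

variable {m : ℕ → ℕ} {c e : ℕ → ℝ}

theorem blockControl_nonneg (hc : ∀ n, 0 ≤ c n) (he : ∀ n, 0 ≤ e n) (r : ℝ) :
    0 ≤ blockControl m c e r :=
  add_nonneg (Finset.sum_nonneg fun k _ => add_nonneg (mul_nonneg (by positivity) (hc k)) (he k))
    (mul_nonneg (hc _) (by positivity))

theorem mul_subIndex_le (hc : ∀ n, 0 ≤ c n) (r : ℝ) :
    c ⌊r⌋₊ * subIndex m r ≤ ((m ⌊r⌋₊ : ℝ) + 1) * c ⌊r⌋₊ := by
  have h : (subIndex m r : ℝ) ≤ m ⌊r⌋₊ := by exact_mod_cast subIndex_le m r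
  nlinarith [hc ⌊r⌋₊]

theorem blockControl_le_sum (hc : ∀ n, 0 ≤ c n) (r : ℝ) :
    blockControl m c e r + e ⌊r⌋₊ ≤
      ∑ k ∈ Finset.range (⌊r⌋₊ + 1), (((m k : ℝ) + 1) * c k + e k) := by
  rw [Finset.sum_range_succ]
  unfold blockControl
  linarith [mul_subIndex_le (m := m) hc r]

theorem blockControl_le_tsum (hc : ∀ n, 0 ≤ c n) (he : ∀ n, 0 ≤ e n)
    (hs : Summable fun k => ((m k : ℝ) + 1) * c k + e k) (r : ℝ) :
    blockControl m c e r ≤ ∑' k, (((m k : ℝ) + 1) * c k + e k) := by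
  have h := hs.sum_le_tsum (Finset.range (⌊r⌋₊ + 1))
    fun k _ => add_nonneg (mul_nonneg (by positivity) (hc k)) (he k)
  linarith [blockControl_le_sum (m := m) (e := e) hc r, he ⌊r⌋₊]

theorem norm_rpow_le_blockControl_sub {E : Type*} [NormedAddCommGroup E] {p : ℝ} (hp : 0 < p)
    {y : ℕ → ℕ → E} (hc : ∀ n i j, ‖y n i - y n j‖ ^ p ≤ c n)
    (he : ∀ n k, n < k → ∀ i j, ‖y k j - y n i‖ ^ p ≤ e n) {r s : ℝ} (hrs : r ≤ s) :
    ‖y ⌊s⌋₊ (subIndex m s) - y ⌊r⌋₊ (subIndex m r)‖ ^ p ≤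
      blockControl m c e s - blockControl m c e r := by
  have hc0 : ∀ n, 0 ≤ c n := fun n => le_trans (by positivity) (hc n 0 0)
  have he0 : ∀ n, 0 ≤ e n := fun n => le_trans (by positivity) (he n _ n.lt_succ_self 0 0)
  rcases (Nat.floor_mono hrs).eq_or_lt with hf | hf
  · have hj := subIndex_mono (m := m) hrs hf
    unfold blockControl
    rw [hf]
    rcases hj.eq_or_lt with hj | hj
    · simp [hj, Real.zero_rpow hp.ne']
    · have hj' : (subIndex m r : ℝ) + 1 ≤ subIndex m s := by exact_mod_cast hj
      nlinarith [hc ⌊s⌋₊ (subIndex m s) (subIndex m r), hc0 ⌊s⌋₊]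
  · refine (he _ _ hf _ _).trans ?_
    have h1 := blockControl_le_sum (m := m) (e := e) hc0 r
    have h2 : ∑ k ∈ Finset.range (⌊r⌋₊ + 1), (((m k : ℝ) + 1) * c k + e k) ≤
        ∑ k ∈ Finset.range ⌊s⌋₊, (((m k : ℝ) + 1) * c k + e k) :=
      Finset.sum_le_sum_of_subset_of_nonneg (Finset.range_mono hf)
        fun k _ _ => add_nonneg (mul_nonneg (by positivity) (hc0 k)) (he0 k)
    have h3 : 0 ≤ c ⌊s⌋₊ * subIndex m s := mul_nonneg (hc0 _) (by positivity)
    unfold blockControl at h1 ⊢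
    linarith

end BlockStep

section Composition

variable {E : Type*} [NormedAddCommGroup E] {p q a b : ℝ}

/-- If `f` maps `BV_p` into `BV_q`, then its oscillation along the blocks of a step function of
bounded `p`-variation is bounded. -/
theorem exists_bound_of_comp_maps_BV (hp : 0 < p) (hq : 0 < q) (hab : a < b) {f : E → E}
    (hf : ∀ x : ℝ → E, pVar p a b x ≠ ⊤ → pVar q a b (fun t => f (x t)) ≠ ⊤)
    (y : ℕ → ℕ → E) (m : ℕ → ℕ) {c e : ℕ → ℝ}
    (hc : ∀ n i j, ‖y n i - y n j‖ ^ p ≤ c n)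
    (he : ∀ n k, n < k → ∀ i j, ‖y k j - y n i‖ ^ p ≤ e n)
    (hsc : Summable fun n => ((m n : ℝ) + 1) * c n) (hse : Summable e) :
    ∃ C : ℝ, (∀ n, ∑ i : Fin (m n), ‖f (y n (i + 1)) - f (y n i)‖ ^ q ≤ C) ∧
      ∀ n, ‖f (y n 0) - f (y 0 0)‖ ^ q ≤ C := by
  have hc0 : ∀ n, 0 ≤ c n := fun n => le_trans (by positivity) (hc n 0 0)
  have he0 : ∀ n, 0 ≤ e n := fun n => le_trans (by positivity) (he n _ n.lt_succ_self 0 0)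
  let X : ℝ → E := fun r => y ⌊r⌋₊ (subIndex m r)
  let τ : ℝ → ℝ := fun t => (t - a) / (b - t)
  let σ : ℝ → ℝ := fun r => (a + b * r) / (1 + r)
  let x : ℝ → E := fun t => if t < b then X (τ t) else y 0 0
  have hτ : ∀ s t, s < t → t < b → τ s ≤ τ t := fun s t hst htb => by
    simp only [τ]
    rw [div_le_div_iff₀ (by linarith) (by linarith)]
    nlinarith
  have hσ : ∀ r s, 0 < r → r < s → σ r < σ s := fun r s hr hrs => by
    simp only [σ]
    rw [div_lt_div_iff₀ (by linarith) (by linarith)]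
    nlinarith
  have hσa : ∀ r, 0 < r → a < σ r := fun r hr => by
    simp only [σ]
    rw [lt_div_iff₀ (by linarith)]
    nlinarith
  have hσb : ∀ r, 0 < r → σ r < b := fun r hr => by
    simp only [σ]
    rw [div_lt_iff₀ (by linarith)]
    nlinarith
  have hτσ : ∀ r, 0 < r → τ (σ r) = r := fun r hr => by
    have h1 : 1 + r ≠ 0 := by linarith
    have h2 : b - (a + b * r) / (1 + r) ≠ 0 := by linarith [hσb r hr]
    simp only [τ, σ]
    rw [div_eq_iff h2]
    field_simp
    ring
  have hxσ : ∀ n j, j ≤ m n → x (σ (subMidpoint m n j)) = y n j := fun n j hj => by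
    have h0 : 0 < subMidpoint m n j := n.cast_nonneg.trans_lt (cast_lt_subMidpoint m n j)
    simp only [x, X]
    rw [if_pos (hσb _ h0), hτσ _ h0, floor_subMidpoint hj, subIndex_subMidpoint hj]
  have hx : pVar p a b x ≠ ⊤ := by
    let S := ∑' k, (((m k : ℝ) + 1) * c k + e k)
    refine pVar_ne_top_of_control hp.le
      (fun t => if t < b then blockControl m c e (τ t) else S + (c 0 + e 0)) ?_
    intro s t _ hst htb
    have hsb : s < b := hst.trans_le htb
    rcases htb.lt_or_eq with htb | rfl
    · simp only [x, X, if_pos htb, if_pos hsb]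
      exact norm_rpow_le_blockControl_sub hp hc he (hτ s t hst htb)
    · simp only [x, X, if_pos hsb, lt_irrefl, if_false]
      have h1 : blockControl m c e (τ s) ≤ S := blockControl_le_tsum hc0 he0 (hsc.add hse) _
      have h2 : ‖y 0 0 - y ⌊τ s⌋₊ (subIndex m (τ s))‖ ^ p ≤ c 0 + e 0 := by
        rcases Nat.eq_zero_or_pos ⌊τ s⌋₊ with h | h
        · rw [h]
          exact (hc _ _ _).trans (le_add_of_nonneg_right (he0 0))
        · rw [norm_sub_rev]
          exact (he _ _ h _ _).trans (le_add_of_nonneg_left (hc0 0))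
      linarith
  have hpos : ∀ n j, 0 < subMidpoint m n j := fun n j =>
    n.cast_nonneg.trans_lt (cast_lt_subMidpoint m n j)
  have hfx := hf x hx
  refine ⟨(pVar q a b fun t => f (x t)).toReal, fun n => ?_, fun n => ?_⟩
  · have h := sum_le_pVar hq.le hfx (n := m n) (fun i => σ (subMidpoint m n i))
      (fun i j hij => hσ _ _ (hpos _ _) (subMidpoint_strictMono m n hij))
      (fun i => hσa _ (hpos _ _)) fun i => hσb _ (hpos _ _)
    refine le_trans (le_of_eq (Finset.sum_congr rfl fun i _ => ?_)) h
    rw [hxσ _ _ (by simp), hxσ _ _ (by simp [i.is_lt.le])]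
    simp
  · rcases Nat.eq_zero_or_pos n with rfl | hn
    · simp [Real.zero_rpow hq.ne']
    have hlt : subMidpoint m 0 0 < subMidpoint m n 0 := by
      refine lt_of_lt_of_le ?_ ((Nat.one_le_cast.2 hn).trans (cast_lt_subMidpoint m n 0).le)
      have h := Nat.lt_floor_add_one (subMidpoint m 0 0)
      rwa [floor_subMidpoint (Nat.zero_le _), Nat.cast_zero, zero_add] at h
    have h := sum_le_pVar hq.le hfx (n := 1) ![σ (subMidpoint m 0 0), σ (subMidpoint m n 0)]
      (by
        refine Fin.strictMono_iff_lt_succ.2 fun i => ?_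
        fin_cases i
        exact hσ _ _ (hpos _ _) hlt)
      (by simp [Fin.forall_fin_two, hσa _ (hpos _ _)])
      (by simp [Fin.forall_fin_two, hσb _ (hpos _ _)])
    simpa [hxσ] using h

/-- A Cauchy sequence has a rapidly Cauchy subsequence whose terms satisfy prescribed eventual
properties. -/
theorem CauchySeq.exists_subseq_dist_lt {X : Type*} [PseudoMetricSpace X] {u : ℕ → X}
    (hu : CauchySeq u) {ε : ℕ → ℝ} (hε : ∀ n, 0 < ε n) {P : ℕ → ℕ → Prop}
    (hP : ∀ n, ∀ᶠ k in atTop, P n k) :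
    ∃ φ : ℕ → ℕ, StrictMono φ ∧ (∀ n k, n ≤ k → dist (u (φ k)) (u (φ n)) < ε n) ∧
      ∀ n, P n (φ n) := by
  have h : ∀ n, ∀ᶠ k in atTop, (∀ l ≥ k, dist (u l) (u k) < ε n) ∧ P n k := fun n => by
    refine Filter.Eventually.and ?_ (hP n)
    obtain ⟨N, hN⟩ := Metric.cauchySeq_iff.1 hu (ε n) (hε n)
    filter_upwards [eventually_ge_atTop N] with k hk l hl
    exact hN l (le_trans hk hl) k hk
  obtain ⟨φ, hφ, hφP⟩ := extraction_forall_of_eventually h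
  exact ⟨φ, hφ, fun n k hnk => (hφP n).1 _ (hφ.monotone hnk), fun n => (hφP n).2⟩

theorem norm_rpow_le_half_pow (hp : 1 ≤ p) {z : E} {n : ℕ} (hz : ‖z‖ ≤ (1 / 2 : ℝ) ^ n) :
    ‖z‖ ^ p ≤ (1 / 2 : ℝ) ^ n :=
  (Real.rpow_le_self_of_le_one (norm_nonneg z)
    (hz.trans (pow_le_one₀ (by norm_num) (by norm_num))) hp).trans hz

/-- If `f` maps `BV_p` into `BV_q`, then `f` is bounded on totally bounded sets. -/
theorem exists_norm_le_of_comp_maps_BV (hp : 1 ≤ p) (hq : 0 < q) (hab : a < b) {f : E → E}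
    (hf : ∀ x : ℝ → E, pVar p a b x ≠ ⊤ → pVar q a b (fun t => f (x t)) ≠ ⊤)
    {K : Set E} (hK : TotallyBounded K) : ∃ M : ℝ, ∀ u ∈ K, ‖f u‖ ≤ M := by
  by_contra! h
  choose v hvK hv using fun n : ℕ => h n
  obtain ⟨φ, hφ, hvφ⟩ := hK.exists_cauchySeq_subseq hvK
  obtain ⟨ψ, hψ, hd, -⟩ := hvφ.exists_subseq_dist_lt (ε := fun n => (1 / 2 : ℝ) ^ n)
    (fun n => by positivity) (P := fun _ _ => True) (fun n => Eventually.of_forall fun _ => trivial)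
  have hp0 : p ≠ 0 := by linarith
  obtain ⟨C, -, hC⟩ := exists_bound_of_comp_maps_BV (by linarith) hq hab hf
    (fun n _ => v (φ (ψ n))) (fun _ => 0) (c := fun _ => 0) (e := fun n => (1 / 2 : ℝ) ^ n)
    (fun n _ _ => by simp [Real.zero_rpow hp0])
    (fun n k hnk _ _ => norm_rpow_le_half_pow hp (by
      rw [← dist_eq_norm]
      exact (hd n k hnk.le).le))
    (by simp) summable_geometric_two
  have hC0 : 0 ≤ C := le_trans (by positivity) (hC 0)
  obtain ⟨n, hn⟩ := exists_nat_gt (C ^ (1 / q) + ‖f (v (φ (ψ 0)))‖)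
  have h1 : ‖f (v (φ (ψ n))) - f (v (φ (ψ 0)))‖ ≤ C ^ (1 / q) := by
    rw [one_div]
    exact (Real.le_rpow_inv_iff_of_pos (norm_nonneg _) hC0 hq).2 (hC n)
  have h2 : (n : ℝ) ≤ φ (ψ n) := by exact_mod_cast (hφ.comp hψ).le_apply
  linarith [hv (φ (ψ n)), norm_sub_norm_le (f (v (φ (ψ n)))) (f (v (φ (ψ 0))))]

/-- Alternation between `u` and `w`. -/
def alternate (u w : E) (j : ℕ) : E := if Even j then u else w

theorem norm_alternate_sub_le (u w : E) (i j : ℕ) :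
    ‖alternate u w i - alternate u w j‖ ≤ ‖u - w‖ := by
  unfold alternate
  split_ifs <;> simp [norm_sub_rev]

theorem norm_map_alternate_succ_sub (f : E → E) (u w : E) (j : ℕ) :
    ‖f (alternate u w (j + 1)) - f (alternate u w j)‖ = ‖f u - f w‖ := by
  unfold alternate
  by_cases h : Even j <;> simp [h, Nat.even_add_one, norm_sub_rev]

theorem norm_alternate_sub_alternate_le {u w u' w' : E} {δ : ℝ} (h : ‖u - w‖ ≤ δ)
    (hu : ‖u' - u‖ ≤ δ) (hw : ‖w' - w‖ ≤ δ) (i j : ℕ) :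
    ‖alternate u' w' j - alternate u w i‖ ≤ 2 * δ := by
  have h1 : ‖alternate u' w' j - alternate u w j‖ ≤ δ := by
    unfold alternate
    split_ifs <;> assumption
  have h2 := norm_sub_le_norm_sub_add_norm_sub (alternate u' w' j) (alternate u w j)
    (alternate u w i)
  linarith [norm_alternate_sub_le u w j i]

end Composition

/-- Necessity in the Josephy-type theorem: if the composition operator generated by `f`
maps `BV_p([a,b],E)` into `BV_q([a,b],E)`, then `f` is Hölder continuous with exponent
`p/q` on every precompact (totally bounded) subset of `E`. -/
theorem holder_on_precompact_of_comp_maps_BV {E : Type*} [NormedAddCommGroup E]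
    (p q a b : ℝ) (hp : 1 ≤ p) (hpq : p ≤ q) (hab : a < b)
    (f : E → E)
    (hf : ∀ x : ℝ → E, pVar p a b x ≠ ⊤ → pVar q a b (fun t => f (x t)) ≠ ⊤) :
    ∀ K : Set E, TotallyBounded K → ∃ L : ℝ, 0 ≤ L ∧
      ∀ u ∈ K, ∀ w ∈ K, ‖f u - f w‖ ≤ L * ‖u - w‖ ^ (p / q) := by
  intro K hK
  have hp0 : 0 < p := by linarith
  have hq0 : 0 < q := by linarith
  obtain ⟨M, hM⟩ := exists_norm_le_of_comp_maps_BV hp hq0 hab hf hK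
  by_contra! h
  choose u huK w hwK huw using fun k : ℕ => h k k.cast_nonneg
  have hd0 : ∀ k, 0 < ‖u k - w k‖ := fun k => by
    refine norm_pos_iff.2 fun h0 => ?_
    have := huw k
    rw [sub_eq_zero.1 h0] at this
    simp [Real.zero_rpow (div_pos hp0 hq0).ne'] at this
  have hosc : ∀ k : ℕ, k * ‖u k - w k‖ ^ p ≤ ‖f (u k) - f (w k)‖ ^ q := fun k => by
    have h1 := Real.rpow_le_rpow (by positivity) (huw k).le hq0.le
    rw [Real.mul_rpow (by positivity) (by positivity), ← Real.rpow_mul (norm_nonneg _),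
      div_mul_cancel₀ _ hq0.ne'] at h1
    refine le_trans ?_ h1
    gcongr
    rcases Nat.eq_zero_or_pos k with rfl | hk
    · simp [Real.zero_rpow hq0.ne']
    · exact Real.self_le_rpow_of_one_le (by exact_mod_cast hk) (by linarith)
  have hsmall : ∀ ε > 0, ∀ᶠ k in atTop, ‖u k - w k‖ < ε := fun ε hε => by
    have hεp : 0 < ε ^ p := by positivity
    obtain ⟨N, hN⟩ := exists_nat_gt ((M + M) ^ q / ε ^ p)
    filter_upwards [eventually_ge_atTop N] with k hk
    rw [← Real.rpow_lt_rpow_iff (norm_nonneg _) hε.le hp0]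
    have h1 : ‖f (u k) - f (w k)‖ ^ q ≤ (M + M) ^ q :=
      Real.rpow_le_rpow (norm_nonneg _) ((norm_sub_le _ _).trans
        (add_le_add (hM _ (huK k)) (hM _ (hwK k)))) hq0.le
    rw [div_lt_iff₀ hεp] at hN
    have hk' : (N : ℝ) ≤ k := by exact_mod_cast hk
    by_contra! hcon
    have h2 : (N : ℝ) * ε ^ p ≤ k * ‖u k - w k‖ ^ p := by gcongr
    linarith [hosc k]
  obtain ⟨φ₁, hφ₁, hu⟩ := hK.exists_cauchySeq_subseq huK
  obtain ⟨φ₂, hφ₂, hw⟩ := hK.exists_cauchySeq_subseq fun n => hwK (φ₁ n)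
  have hφ : Tendsto (φ₁ ∘ φ₂) atTop atTop := (hφ₁.comp hφ₂).tendsto_atTop
  have hpair : CauchySeq fun k => (u (φ₁ (φ₂ k)), w (φ₁ (φ₂ k))) :=
    (hu.comp_tendsto hφ₂.tendsto_atTop).prodMk hw
  obtain ⟨ψ, -, hdist, hψ⟩ := hpair.exists_subseq_dist_lt (ε := fun n => (1 / 2 : ℝ) ^ (n + 1))
    (fun n => by positivity)
    (P := fun n k => ‖u (φ₁ (φ₂ k)) - w (φ₁ (φ₂ k))‖ < (1 / 2 : ℝ) ^ (n + 1) ∧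
      n * 2 ^ n ≤ φ₁ (φ₂ k))
    fun n => hφ.eventually ((hsmall _ (by positivity)).and (eventually_ge_atTop _))
  let κ : ℕ → ℕ := fun n => φ₁ (φ₂ (ψ n))
  have hκd : ∀ n, ‖u (κ n) - w (κ n)‖ < (1 / 2 : ℝ) ^ (n + 1) := fun n => (hψ n).1
  have hκ : ∀ n : ℕ, (n : ℝ) * 2 ^ n ≤ κ n := fun n => by exact_mod_cast (hψ n).2
  have hhalf : ∀ n : ℕ, 2 * (1 / 2 : ℝ) ^ (n + 1) = (1 / 2 : ℝ) ^ n := fun n => by ring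
  have hcross : ∀ n k, n < k → ∀ i j, ‖alternate (u (κ k)) (w (κ k)) j -
      alternate (u (κ n)) (w (κ n)) i‖ ^ p ≤ (1 / 2 : ℝ) ^ n := fun n k hnk i j => by
    have hnk' := hdist n k hnk.le
    rw [Prod.dist_eq, max_lt_iff, dist_eq_norm, dist_eq_norm] at hnk'
    refine norm_rpow_le_half_pow hp ?_
    rw [← hhalf]
    exact norm_alternate_sub_alternate_le (hκd n).le hnk'.1.le hnk'.2.le i j
  have hdp0 : ∀ n, 0 < ‖u (κ n) - w (κ n)‖ ^ p := fun n => Real.rpow_pos_of_pos (hd0 _) p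
  let m : ℕ → ℕ := fun n => ⌈(1 / 2 : ℝ) ^ n / ‖u (κ n) - w (κ n)‖ ^ p⌉₊
  have hm : ∀ n, ((m n : ℝ) + 1) * ‖u (κ n) - w (κ n)‖ ^ p ≤ 3 * (1 / 2 : ℝ) ^ n := fun n => by
    have h1 : (m n : ℝ) < (1 / 2 : ℝ) ^ n / ‖u (κ n) - w (κ n)‖ ^ p + 1 :=
      Nat.ceil_lt_add_one (by positivity)
    have h2 : ‖u (κ n) - w (κ n)‖ ^ p ≤ (1 / 2 : ℝ) ^ n :=
      norm_rpow_le_half_pow hp ((hκd n).le.trans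
        (pow_le_pow_of_le_one (by norm_num) (by norm_num) n.le_succ))
    have h3 := mul_le_mul_of_nonneg_right h1.le (hdp0 n).le
    rw [add_mul, div_mul_cancel₀ _ (hdp0 n).ne'] at h3
    linarith
  obtain ⟨C, hC, -⟩ := exists_bound_of_comp_maps_BV hp0 hq0 hab hf
    (fun n => alternate (u (κ n)) (w (κ n))) m (c := fun n => ‖u (κ n) - w (κ n)‖ ^ p)
    (fun n i j => Real.rpow_le_rpow (norm_nonneg _) (norm_alternate_sub_le _ _ i j) hp0.le)
    hcross
    (Summable.of_nonneg_of_le (fun n => by positivity) hm (summable_geometric_two.mul_left 3))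
    summable_geometric_two
  obtain ⟨n, hn⟩ := exists_nat_gt C
  have hCn := hC n
  simp only [norm_map_alternate_succ_sub, Finset.sum_const, Finset.card_univ, Fintype.card_fin,
    nsmul_eq_mul] at hCn
  have hmn : (1 / 2 : ℝ) ^ n / ‖u (κ n) - w (κ n)‖ ^ p ≤ m n := Nat.le_ceil _
  have : (n : ℝ) ≤ m n * ‖f (u (κ n)) - f (w (κ n))‖ ^ q :=
    calc (n : ℝ) = (1 / 2 : ℝ) ^ n * (n * 2 ^ n) := by
          rw [mul_left_comm, ← mul_pow]
          norm_num
      _ ≤ (1 / 2 : ℝ) ^ n * κ n := by gcongr; exact hκ n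
      _ = (1 / 2 : ℝ) ^ n / ‖u (κ n) - w (κ n)‖ ^ p * (κ n * ‖u (κ n) - w (κ n)‖ ^ p) := by
          have := (hdp0 n).ne'
          field_simp
      _ ≤ m n * ‖f (u (κ n)) - f (w (κ n))‖ ^ q := by
          gcongr
          exact hosc (κ n)
  linarith
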